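/- Let a, b, c be real numbers with a² + c² = 1/2, b² = 1/2, and c ≠ 0, and set λ = a·b (so |λ| < 1/2). Define F : ℤ → ℝ by F(n) = (1/(2π)) ∫_{−π}^{π} e^{ikn}·(1 + 2λ·cos k)^{−1/2} dk, and define W₁, W₂ : ℤ → ℝ by W₁(n) = a·F(n) + b·F(n−1) and W₂(n) = c·F(n). Then the series below converge absolutely and Σ_{n∈ℤ} n²·(W₁(n)² + W₂(n)²) − (Σ_{n∈ℤ} n·(W₁(n)² + W₂(n)²))² = 1/(4·√(1 − 4λ²)). -/

import Mathlib

open Complex Real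

open MeasureTheory in
/-- Parseval's identity on `[-π, π]` for the coefficients `(2π)⁻¹ ∫ e^{ikn} h(k) dk`. -/
lemma hasSum_norm_sq_integral_exp_mul {h : ℝ → ℂ} (hh : Continuous h) :
    HasSum (fun n : ℤ => ‖(1 / (2 * Real.pi)) • ∫ k in (-Real.pi)..Real.pi,
        Complex.exp (Complex.I * (k : ℂ) * (n : ℂ)) * h k‖ ^ 2)
      (1 / (2 * Real.pi) * ∫ k in (-Real.pi)..Real.pi, ‖h k‖ ^ 2) := by
  have hab : -Real.pi < Real.pi := by linarith [Real.pi_pos]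
  have hL2 : MemLp h 2 (volume.restrict (Set.Ioc (-Real.pi) Real.pi)) := by
    obtain ⟨C, hC⟩ := isCompact_Icc.exists_bound_of_continuousOn
      (s := Set.Icc (-Real.pi) Real.pi) hh.continuousOn
    refine MemLp.of_bound hh.aestronglyMeasurable C ?_
    filter_upwards [ae_restrict_mem measurableSet_Ioc] with x hx
    exact hC x (Set.Ioc_subset_Icc_self hx)
  have key := (Equiv.neg ℤ).hasSum_iff.mpr (hasSum_sq_fourierCoeffOn hab hL2)
  have hlen : Real.pi - -Real.pi = 2 * Real.pi := by ring
  convert key using 1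
  · ext n
    simp only [Function.comp_apply, Equiv.neg_apply]
    rw [fourierCoeffOn_eq_integral, neg_neg, ← hlen]
    congr 3
    refine intervalIntegral.integral_congr fun x _ => ?_
    simp only [smul_eq_mul]
    rw [fourier_coe_apply]
    congr 2
    have : (Real.pi : ℂ) ≠ 0 := by exact_mod_cast Real.pi_ne_zero
    push_cast
    field_simp
    ring
  · rw [hlen, smul_eq_mul, one_div]

/-- The Fourier coefficients of the derivative of a function with equal values at `±π`. -/
lemma integral_exp_mul_deriv {h h' : ℝ → ℂ} (hh : ∀ k, HasDerivAt h (h' k) k)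
    (hc : Continuous h') (hper : h (-Real.pi) = h Real.pi) (n : ℤ) :
    ∫ k in (-Real.pi)..Real.pi, Complex.exp (Complex.I * (k : ℂ) * (n : ℂ)) * h' k =
      -(Complex.I * n) * ∫ k in (-Real.pi)..Real.pi,
        Complex.exp (Complex.I * (k : ℂ) * (n : ℂ)) * h k := by
  have hexp : ∀ k : ℝ, HasDerivAt (fun k : ℝ => Complex.exp (Complex.I * (k : ℂ) * (n : ℂ)))
      (Complex.I * n * Complex.exp (Complex.I * (k : ℂ) * (n : ℂ))) k := by
    intro k
    have h1 : HasDerivAt (fun z : ℂ => Complex.exp (Complex.I * z * n))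
        (Complex.exp (Complex.I * k * n) * (Complex.I * 1 * n)) (k : ℂ) :=
      (((hasDerivAt_id (k : ℂ)).const_mul Complex.I).mul_const (n : ℂ)).cexp
    convert h1.comp_ofReal using 1
    ring
  rw [intervalIntegral.integral_mul_deriv_eq_deriv_mul (fun x _ => hexp x) (fun x _ => hh x)
    (Continuous.intervalIntegrable (by fun_prop) _ _) (hc.intervalIntegrable _ _), hper]
  have hend : Complex.exp (Complex.I * ((-Real.pi : ℝ) : ℂ) * n) =
      Complex.exp (Complex.I * (Real.pi : ℂ) * n) := by
    rw [Complex.exp_eq_exp_iff_exists_int]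
    exact ⟨-n, by push_cast; ring⟩
  rw [hend, sub_self, zero_sub, ← intervalIntegral.integral_const_mul,
    ← intervalIntegral.integral_neg]
  refine intervalIntegral.integral_congr fun x _ => ?_
  ring

/-- Parseval's identity for the derivative, on `[-π, π]`. -/
lemma hasSum_sq_mul_norm_sq_integral_exp_mul {h h' : ℝ → ℂ} (hh : ∀ k, HasDerivAt h (h' k) k)
    (hc : Continuous h') (hper : h (-Real.pi) = h Real.pi) :
    HasSum (fun n : ℤ => (n : ℝ) ^ 2 * ‖(1 / (2 * Real.pi)) • ∫ k in (-Real.pi)..Real.pi,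
        Complex.exp (Complex.I * (k : ℂ) * (n : ℂ)) * h k‖ ^ 2)
      (1 / (2 * Real.pi) * ∫ k in (-Real.pi)..Real.pi, ‖h' k‖ ^ 2) := by
  convert hasSum_norm_sq_integral_exp_mul hc using 2 with n
  rw [integral_exp_mul_deriv hh hc hper, norm_smul, norm_smul, norm_mul, norm_neg, norm_mul,
    Complex.norm_I, Complex.norm_intCast, mul_pow, mul_pow, mul_pow, one_mul, sq_abs]
  ring

lemma one_add_two_mul_mul_cos_pos {lam : ℝ} (hl : |lam| < 1 / 2) (k : ℝ) :
    0 < 1 + 2 * lam * Real.cos k := by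
  have h1 : |lam * Real.cos k| ≤ |lam| := by
    rw [abs_mul]
    exact mul_le_of_le_one_right (abs_nonneg _) (Real.abs_cos_le_one k)
  linarith [neg_abs_le (lam * Real.cos k)]

lemma continuous_one_div_one_add_two_mul_mul_cos {lam : ℝ} (hl : |lam| < 1 / 2) :
    Continuous fun k : ℝ => 1 / (1 + 2 * lam * Real.cos k) :=
  Continuous.div continuous_const (by fun_prop) fun k => (one_add_two_mul_mul_cos_pos hl k).ne'

lemma one_sub_four_mul_sq_pos {lam : ℝ} (hl : |lam| < 1 / 2) : 0 < 1 - 4 * lam ^ 2 := by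
  have := abs_lt.mp hl
  nlinarith

/-- The mean of `(1 + 2λ cos k)⁻¹` over a period, via the antiderivative of the Poisson kernel. -/
lemma integral_one_div_one_add_two_mul_mul_cos {lam : ℝ} (hl : |lam| < 1 / 2) :
    ∫ k in (-Real.pi)..Real.pi, 1 / (1 + 2 * lam * Real.cos k) =
      2 * Real.pi / Real.sqrt (1 - 4 * lam ^ 2) := by
  have hpos := one_sub_four_mul_sq_pos hl
  set s := Real.sqrt (1 - 4 * lam ^ 2) with hs
  have hs0 : 0 < s := Real.sqrt_pos.mpr hpos
  have hs2 : s ^ 2 = 1 - 4 * lam ^ 2 := Real.sq_sqrt hpos.le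
  obtain ⟨r, hr⟩ : ∃ r, r * (1 + s) = -2 * lam := ⟨-2 * lam / (1 + s), by field_simp⟩
  have hr2 : (1 + r ^ 2) * (1 + s) = 2 := by
    have : (1 + s) ≠ 0 := by positivity
    apply mul_right_cancel₀ this
    linear_combination (r * (1 + s) - 2 * lam) * hr + hs2
  have hr3 : (1 - r ^ 2) = s * (1 + r ^ 2) := by linarith
  have hrlam : -2 * r = 2 * lam * (1 + r ^ 2) := by
    have : (1 + s) ≠ 0 := by positivity
    apply mul_right_cancel₀ this
    linear_combination -2 * hr - 2 * lam * hr2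
  have hr1 : r ^ 2 < 1 := by nlinarith [mul_pos hs0 (by positivity : 0 < 1 + r ^ 2)]
  have habs : |r| < 1 := by rwa [← sq_lt_one_iff_abs_lt_one]
  have hden : ∀ k, 0 < 1 - r * Real.cos k := by
    intro k
    have h1 : |r * Real.cos k| ≤ |r| := by
      rw [abs_mul]
      exact mul_le_of_le_one_right (abs_nonneg _) (Real.abs_cos_le_one k)
    linarith [le_abs_self (r * Real.cos k)]
  have hderiv : ∀ k : ℝ, HasDerivAt
      (fun k => (k + 2 * Real.arctan (r * Real.sin k / (1 - r * Real.cos k))) / s)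
      (1 / (1 + 2 * lam * Real.cos k)) k := by
    intro k
    have hd := (((hasDerivAt_id k).add ((((Real.hasDerivAt_sin k).const_mul r).div
      (((Real.hasDerivAt_cos k).const_mul r).const_sub 1) (hden k).ne').arctan.const_mul
        2)).div_const s)
    refine hd.congr_deriv ?_
    have hg := one_add_two_mul_mul_cos_pos hl k
    have hd0 := hden k
    have hsc := Real.sin_sq_add_cos_sq k
    have hq : 0 < (1 - r * Real.cos k) ^ 2 + (r * Real.sin k) ^ 2 := by positivity
    have hqg : (1 - r * Real.cos k) ^ 2 + (r * Real.sin k) ^ 2 =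
        (1 + r ^ 2) * (1 + 2 * lam * Real.cos k) := by
      linear_combination r ^ 2 * hsc + Real.cos k * hrlam
    have hinner : 1 / (1 + (r * Real.sin k / (1 - r * Real.cos k)) ^ 2) *
        ((r * Real.cos k * (1 - r * Real.cos k) - r * Real.sin k * -(r * -Real.sin k)) /
          (1 - r * Real.cos k) ^ 2) =
        (r * Real.cos k - r ^ 2) / ((1 + r ^ 2) * (1 + 2 * lam * Real.cos k)) := by
      rw [← hqg, div_pow, one_add_div (by positivity), one_div_div, div_mul_div_comm,
        div_eq_div_iff (by positivity) hq.ne']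
      linear_combination -(1 - r * Real.cos k) ^ 2 *
        ((1 - r * Real.cos k) ^ 2 + (r * Real.sin k) ^ 2) * r ^ 2 * hsc
    simp only [Pi.div_apply]
    rw [hinner]
    obtain ⟨G, hG⟩ : ∃ G, G = 1 + 2 * lam * Real.cos k := ⟨_, rfl⟩
    rw [← hG] at hg ⊢
    field_simp
    linear_combination hr3 - Real.cos k * hrlam + (1 + r ^ 2) * hG
  rw [intervalIntegral.integral_eq_sub_of_hasDerivAt (fun x _ => hderiv x)
    ((continuous_one_div_one_add_two_mul_mul_cos hl).intervalIntegrable _ _)]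
  simp
  ring

/-- The mean of the spread density `1/(2g) - λ² sin² k / g²` with `g = 1 + 2λ cos k`. -/
lemma integral_spread_density {lam : ℝ} (hl : |lam| < 1 / 2) :
    ∫ k in (-Real.pi)..Real.pi, (1 / 2 / (1 + 2 * lam * Real.cos k) -
        lam ^ 2 * Real.sin k ^ 2 / (1 + 2 * lam * Real.cos k) ^ 2) =
      2 * Real.pi * (1 / 4 + 1 / (4 * Real.sqrt (1 - 4 * lam ^ 2))) := by
  have hg := one_add_two_mul_mul_cos_pos hl
  have hderiv : ∀ k : ℝ, HasDerivAt
      (fun k => lam / 2 * (Real.sin k / (1 + 2 * lam * Real.cos k)))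
      (1 / 4 + 1 / 4 * (1 / (1 + 2 * lam * Real.cos k)) - (1 / 2 / (1 + 2 * lam * Real.cos k) -
        lam ^ 2 * Real.sin k ^ 2 / (1 + 2 * lam * Real.cos k) ^ 2)) k := by
    intro k
    refine (((Real.hasDerivAt_sin k).div
      (((Real.hasDerivAt_cos k).const_mul (2 * lam)).const_add 1)
        (hg k).ne').const_mul (lam / 2)).congr_deriv ?_
    have hgk := (hg k).ne'
    obtain ⟨G, hG⟩ : ∃ G, G = 1 + 2 * lam * Real.cos k := ⟨_, rfl⟩
    rw [← hG] at hgk ⊢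
    field_simp
    linear_combination -2 * G * hG
  have hinv := continuous_one_div_one_add_two_mul_mul_cos hl
  have hi1 : IntervalIntegrable (fun k => 1 / 4 + 1 / 4 * (1 / (1 + 2 * lam * Real.cos k)))
      MeasureTheory.volume (-Real.pi) Real.pi :=
    Continuous.intervalIntegrable (by fun_prop) _ _
  have hi2 : IntervalIntegrable (fun k => 1 / 2 / (1 + 2 * lam * Real.cos k) -
      lam ^ 2 * Real.sin k ^ 2 / (1 + 2 * lam * Real.cos k) ^ 2)
      MeasureTheory.volume (-Real.pi) Real.pi := by
    refine Continuous.intervalIntegrable (Continuous.sub ?_ ?_) _ _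
    · exact Continuous.div (by fun_prop) (by fun_prop) fun k => (hg k).ne'
    · exact Continuous.div (by fun_prop) (by fun_prop) fun k => pow_ne_zero 2 (hg k).ne'
  have h0 := intervalIntegral.integral_eq_sub_of_hasDerivAt (fun x _ => hderiv x) (hi1.sub hi2)
  rw [intervalIntegral.integral_sub hi1 hi2, intervalIntegral.integral_add (by simp)
    ((hinv.intervalIntegrable _ _).const_mul _), intervalIntegral.integral_const_mul,
    integral_one_div_one_add_two_mul_mul_cos hl] at h0
  simp at h0
  have hs0 : 0 < Real.sqrt (1 - 4 * lam ^ 2) := Real.sqrt_pos.mpr (one_sub_four_mul_sq_pos hl)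
  field_simp at h0 ⊢
  linarith

lemma hasDerivAt_one_add_two_mul_mul_cos_rpow {lam : ℝ} (hl : |lam| < 1 / 2) (k : ℝ) :
    HasDerivAt (fun k : ℝ => (1 + 2 * lam * Real.cos k) ^ (-(1 / 2) : ℝ))
      (lam * Real.sin k * (1 + 2 * lam * Real.cos k) ^ (-(1 / 2) : ℝ) /
        (1 + 2 * lam * Real.cos k)) k := by
  have hg := one_add_two_mul_mul_cos_pos hl k
  refine ((((Real.hasDerivAt_cos k).const_mul (2 * lam)).const_add 1).rpow_const
    (p := -(1 / 2)) (Or.inl hg.ne')).congr_deriv ?_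
  rw [Real.rpow_sub_one hg.ne']
  ring

lemma sq_one_add_two_mul_mul_cos_rpow {lam : ℝ} (hl : |lam| < 1 / 2) (k : ℝ) :
    ((1 + 2 * lam * Real.cos k) ^ (-(1 / 2) : ℝ)) ^ 2 = 1 / (1 + 2 * lam * Real.cos k) := by
  have hg := one_add_two_mul_mul_cos_pos hl k
  rw [← Real.rpow_natCast, ← Real.rpow_mul hg.le]
  norm_num [Real.rpow_neg_one]

lemma exp_neg_I_mul_ofReal (k : ℝ) :
    Complex.exp (-(Complex.I * k)) = (Real.cos k : ℂ) - Real.sin k * Complex.I := by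
  rw [show -(Complex.I * k) = ((-k : ℝ) : ℂ) * Complex.I by push_cast; ring,
    Complex.exp_mul_I, ← Complex.ofReal_cos, ← Complex.ofReal_sin, Real.cos_neg, Real.sin_neg]
  push_cast
  ring

/-- A distribution symmetric under `n ↦ 1 - n` has mean one half of its mass. -/
lemma two_mul_tsum_mul_of_symm {P : ℤ → ℝ} (hP : ∀ n, P (1 - n) = P n) (h0 : Summable P)
    (h1 : Summable fun n : ℤ => (n : ℝ) * P n) :
    2 * ∑' n : ℤ, (n : ℝ) * P n = ∑' n, P n := by
  have h2 : ∑' n : ℤ, (n : ℝ) * P n = ∑' n, (P n - (n : ℝ) * P n) := by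
    rw [← (Equiv.subLeft (1 : ℤ)).tsum_eq]
    refine tsum_congr fun n => ?_
    simp only [Equiv.subLeft_apply, hP]
    push_cast
    ring
  rw [h0.tsum_sub h1] at h2
  linarith

/-- **Maximal Wannier spread at fixed overlap.** With balanced weights `a² + c² = 1/2`,
`b² = 1/2`, `c ≠ 0`, `λ = ab`, envelope `F(n) = (1/(2π)) ∫_{−π}^{π} e^{ikn}(1+2λcos k)^{−1/2} dk`
and Wannier components `W₁(n) = aF(n) + bF(n−1)`, `W₂(n) = cF(n)`, the spread
`⟨n²⟩ − ⟨n⟩²` equals `1/(4√(1−4λ²))`. -/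
theorem wannier_spread_balanced (a b c lam : ℝ)
    (hac : a ^ 2 + c ^ 2 = 1 / 2) (hb : b ^ 2 = 1 / 2) (hc : c ≠ 0)
    (hlam : lam = a * b)
    (F : ℤ → ℝ)
    (hF : ∀ n : ℤ, ((F n : ℂ)) =
      (1 / (2 * Real.pi)) • ∫ k in (-Real.pi)..Real.pi,
        Complex.exp (Complex.I * (k : ℂ) * (n : ℂ)) *
          (((1 + 2 * lam * Real.cos k) ^ (-(1 / 2) : ℝ) : ℝ) : ℂ))
    (W₁ W₂ : ℤ → ℝ)
    (hW₁ : ∀ n : ℤ, W₁ n = a * F n + b * F (n - 1))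
    (hW₂ : ∀ n : ℤ, W₂ n = c * F n) :
    Summable (fun n : ℤ => |(n : ℝ) ^ 2 * ((W₁ n) ^ 2 + (W₂ n) ^ 2)|) ∧
    Summable (fun n : ℤ => |(n : ℝ) * ((W₁ n) ^ 2 + (W₂ n) ^ 2)|) ∧
    (∑' n : ℤ, (n : ℝ) ^ 2 * ((W₁ n) ^ 2 + (W₂ n) ^ 2)) -
        (∑' n : ℤ, (n : ℝ) * ((W₁ n) ^ 2 + (W₂ n) ^ 2)) ^ 2
      = 1 / (4 * Real.sqrt (1 - 4 * lam ^ 2)) := by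
  have hl : |lam| < 1 / 2 := by
    have hc2 : 0 < c ^ 2 := by positivity
    have : lam ^ 2 < (1 / 2) ^ 2 := by rw [hlam, mul_pow, hb]; nlinarith
    exact abs_lt_of_sq_lt_sq this (by norm_num)
  have hg := one_add_two_mul_mul_cos_pos hl
  set f : ℝ → ℝ := fun k => (1 + 2 * lam * Real.cos k) ^ (-(1 / 2) : ℝ) with hf
  set f' : ℝ → ℝ := fun k => lam * Real.sin k * f k / (1 + 2 * lam * Real.cos k) with hf'
  have hfd : ∀ k, HasDerivAt f (f' k) k := hasDerivAt_one_add_two_mul_mul_cos_rpow hl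
  have hfsq : ∀ k, f k ^ 2 = 1 / (1 + 2 * lam * Real.cos k) := sq_one_add_two_mul_mul_cos_rpow hl
  have hfc : Continuous f := continuous_iff_continuousAt.mpr fun k => (hfd k).continuousAt
  have hf'c : Continuous f' :=
    Continuous.div (by fun_prop) (by fun_prop) fun k => (hg k).ne'
  have hfπ : f (-Real.pi) = f Real.pi := by simp [hf]
  set A : (ℝ → ℂ) → ℤ → ℂ := fun h n => (1 / (2 * Real.pi)) • ∫ k in (-Real.pi)..Real.pi,
    Complex.exp (Complex.I * (k : ℂ) * (n : ℂ)) * h k with hA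
  set h₁ : ℝ → ℂ := fun k => (a + b * Complex.exp (-(Complex.I * k))) * f k with hh₁
  set h₁' : ℝ → ℂ := fun k => b * (-Complex.I * Complex.exp (-(Complex.I * k))) * f k +
    (a + b * Complex.exp (-(Complex.I * k))) * f' k with hh₁'
  set h₂ : ℝ → ℂ := fun k => c * f k with hh₂
  set h₂' : ℝ → ℂ := fun k => c * f' k with hh₂'
  have hh₂d : ∀ k, HasDerivAt h₂ (h₂' k) k := fun k => (hfd k).ofReal_comp.const_mul (c : ℂ)
  have hh₁d : ∀ k, HasDerivAt h₁ (h₁' k) k := by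
    intro k
    have he : HasDerivAt (fun k : ℝ => Complex.exp (-(Complex.I * (k : ℂ))))
        (-Complex.I * Complex.exp (-(Complex.I * k))) k := by
      have h1 : HasDerivAt (fun z : ℂ => Complex.exp (-(Complex.I * z)))
          (Complex.exp (-(Complex.I * k)) * (-(Complex.I * 1))) (k : ℂ) :=
        (((hasDerivAt_id (k : ℂ)).const_mul Complex.I).neg).cexp
      convert h1.comp_ofReal using 1
      ring
    exact ((he.const_mul (b : ℂ)).const_add (a : ℂ)).mul (hfd k).ofReal_comp
  have hh₁c : Continuous h₁ := by fun_prop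
  have hh₂c : Continuous h₂ := by fun_prop
  have hh₁'c : Continuous h₁' := by fun_prop
  have hh₂'c : Continuous h₂' := by fun_prop
  have hh₁π : h₁ (-Real.pi) = h₁ Real.pi := by
    simp only [hh₁, hfπ, exp_neg_I_mul_ofReal]
    simp
  have hh₂π : h₂ (-Real.pi) = h₂ Real.pi := by simp only [hh₂, hfπ]
  have hAW₂ : ∀ n, A h₂ n = W₂ n := by
    intro n
    rw [hW₂, Complex.ofReal_mul, hF n]
    simp only [hA, hh₂]
    rw [mul_smul_comm, ← intervalIntegral.integral_const_mul]
    congr 2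
    ext k
    ring
  have hmode : ∀ (x : ℝ) (n : ℤ), Continuous fun k : ℝ =>
      (x : ℂ) * (Complex.exp (Complex.I * (k : ℂ) * (n : ℂ)) * (f k : ℂ)) := by
    intro x n
    fun_prop
  have hAW₁ : ∀ n, A h₁ n = W₁ n := by
    intro n
    rw [hW₁, Complex.ofReal_add, Complex.ofReal_mul, Complex.ofReal_mul, hF n, hF (n - 1)]
    simp only [hA, hh₁]
    rw [mul_smul_comm, mul_smul_comm, ← intervalIntegral.integral_const_mul,
      ← intervalIntegral.integral_const_mul, ← smul_add, ← intervalIntegral.integral_add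
        (Continuous.intervalIntegrable (hmode a n) _ _)
        (Continuous.intervalIntegrable (hmode b (n - 1)) _ _)]
    congr 2
    ext k
    have : Complex.exp (Complex.I * k * ((n - 1 : ℤ) : ℂ)) =
        Complex.exp (Complex.I * k * n) * Complex.exp (-(Complex.I * k)) := by
      rw [← Complex.exp_add]
      congr 1
      push_cast
      ring
    rw [this]
    ring
  have hFsymm : ∀ n, F (-n) = F n := by
    intro n
    have h : (F (-n) : ℂ) = F n := by
      have hneg := intervalIntegral.integral_comp_neg (a := -Real.pi) (b := Real.pi)
        fun k : ℝ => Complex.exp (Complex.I * (k : ℂ) * (n : ℂ)) *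
          (((1 + 2 * lam * Real.cos k) ^ (-(1 / 2) : ℝ) : ℝ) : ℂ)
      rw [neg_neg] at hneg
      rw [hF, hF, ← hneg]
      congr 2
      ext k
      rw [Real.cos_neg]
      push_cast
      congr 2
      ring
    exact_mod_cast h
  have hn₁ : ∀ n, ‖A h₁ n‖ ^ 2 = W₁ n ^ 2 := by
    intro n
    rw [hAW₁, Complex.norm_real, Real.norm_eq_abs, sq_abs]
  have hn₂ : ∀ n, ‖A h₂ n‖ ^ 2 = W₂ n ^ 2 := by
    intro n
    rw [hAW₂, Complex.norm_real, Real.norm_eq_abs, sq_abs]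
  have hπ := Real.pi_pos
  have hmass : HasSum (fun n : ℤ => W₁ n ^ 2 + W₂ n ^ 2) 1 := by
    have h := (hasSum_norm_sq_integral_exp_mul hh₁c).add (hasSum_norm_sq_integral_exp_mul hh₂c)
    convert h using 1
    · ext n
      rw [← hn₁, ← hn₂]
    · rw [← mul_add, ← intervalIntegral.integral_add
        (Continuous.intervalIntegrable (by fun_prop) _ _)
        (Continuous.intervalIntegrable (by fun_prop) _ _)]
      have : ∀ k, ‖h₁ k‖ ^ 2 + ‖h₂ k‖ ^ 2 = 1 := by
        intro k
        have hq : f k ^ 2 * (1 + 2 * lam * Real.cos k) = 1 := by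
          rw [hfsq, one_div_mul_cancel (hg k).ne']
        simp only [hh₁, hh₂, exp_neg_I_mul_ofReal, ← Complex.normSq_eq_norm_sq,
          Complex.normSq_apply]
        simp [-Complex.ofReal_cos, -Complex.ofReal_sin]
        linear_combination hq + f k ^ 2 * (hac + hb + b ^ 2 * Real.sin_sq_add_cos_sq k) -
          2 * Real.cos k * f k ^ 2 * hlam
      simp only [this]
      simp
      field_simp
      norm_num
  have hsecond : HasSum (fun n : ℤ => (n : ℝ) ^ 2 * (W₁ n ^ 2 + W₂ n ^ 2))
      (1 / 4 + 1 / (4 * Real.sqrt (1 - 4 * lam ^ 2))) := by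
    have h := (hasSum_sq_mul_norm_sq_integral_exp_mul hh₁d hh₁'c hh₁π).add
      (hasSum_sq_mul_norm_sq_integral_exp_mul hh₂d hh₂'c hh₂π)
    convert h using 1
    · ext n
      rw [← hn₁, ← hn₂, mul_add]
    · rw [← mul_add, ← intervalIntegral.integral_add
        (Continuous.intervalIntegrable (by fun_prop) _ _)
        (Continuous.intervalIntegrable (by fun_prop) _ _)]
      have : ∀ k, ‖h₁' k‖ ^ 2 + ‖h₂' k‖ ^ 2 = 1 / 2 / (1 + 2 * lam * Real.cos k) -
          lam ^ 2 * Real.sin k ^ 2 / (1 + 2 * lam * Real.cos k) ^ 2 := by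
        intro k
        have hsc := Real.sin_sq_add_cos_sq k
        have hnorm : ‖h₁' k‖ ^ 2 + ‖h₂' k‖ ^ 2 = 1 / 2 * f k ^ 2 +
            (1 + 2 * lam * Real.cos k) * f' k ^ 2 - 2 * lam * Real.sin k * f k * f' k := by
          simp only [hh₁', hh₂', exp_neg_I_mul_ofReal, ← Complex.normSq_eq_norm_sq,
            Complex.normSq_apply]
          simp [-Complex.ofReal_cos, -Complex.ofReal_sin]
          linear_combination (f k ^ 2 + f' k ^ 2) * (hb + b ^ 2 * hsc) + f' k ^ 2 * hac -
            (2 * Real.cos k * f' k ^ 2 - 2 * Real.sin k * f k * f' k) * hlam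
        have hgk := (hg k).ne'
        have hf'1 : f' k = lam * Real.sin k * f k / (1 + 2 * lam * Real.cos k) := rfl
        have : 1 / 2 * f k ^ 2 +
            (1 + 2 * lam * Real.cos k) * f' k ^ 2 - 2 * lam * Real.sin k * f k * f' k =
            f k ^ 2 * (1 / 2 - lam ^ 2 * Real.sin k ^ 2 / (1 + 2 * lam * Real.cos k)) := by
          rw [hf'1]
          field_simp
          ring
        rw [hnorm, this, hfsq]
        field_simp
      simp only [this, integral_spread_density hl]
      field_simp
  have hPnonneg : ∀ n, 0 ≤ W₁ n ^ 2 + W₂ n ^ 2 := fun n => by positivity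
  have hfirst : Summable (fun n : ℤ => |(n : ℝ) * (W₁ n ^ 2 + W₂ n ^ 2)|) := by
    refine Summable.of_nonneg_of_le (fun _ => abs_nonneg _) (fun n => ?_)
      (hmass.summable.add hsecond.summable)
    rw [abs_mul, abs_of_nonneg (hPnonneg n)]
    nlinarith [hPnonneg n, sq_abs (n : ℝ), sq_nonneg (|(n : ℝ)| - 1),
      mul_nonneg (hPnonneg n) (sq_nonneg (|(n : ℝ)| - 1)),
      mul_nonneg (hPnonneg n) (sq_nonneg (n : ℝ))]
  have hsymm : ∀ n, W₁ (1 - n) ^ 2 + W₂ (1 - n) ^ 2 = W₁ n ^ 2 + W₂ n ^ 2 := by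
    intro n
    have e1 : F (1 - n) = F (n - 1) := by rw [← hFsymm, neg_sub]
    have e2 : F (1 - n - 1) = F n := by rw [← hFsymm]; congr 1; ring
    rw [hW₁, hW₂, hW₁, hW₂, e1, e2]
    linear_combination (F (n - 1) ^ 2 - F n ^ 2) * (hac - hb)
  have hmean := two_mul_tsum_mul_of_symm hsymm hmass.summable hfirst.of_abs
  refine ⟨hsecond.summable.abs, hfirst, ?_⟩
  rw [hmass.tsum_eq] at hmean
  rw [hsecond.tsum_eq, show ∑' n : ℤ, (n : ℝ) * (W₁ n ^ 2 + W₂ n ^ 2) = 1 / 2 by linarith]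
  ring
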